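/- Let L/K be a finite Galois extension, ψ : B → Gal(L/K) an epimorphism of finite groups, K ⊆ L_0 ⊆ L an intermediate field, and B_0 a subgroup of B which ψ maps isomorphically onto Gal(L/L_0). Then there exist a finitely generated regular extension E of K and a finite Galois extension F of E containing L with Gal(F/E) = B and ψ = res_{F/L}, such that moreover the fixed field F_0 of B_0 in F is a purely transcendental extension of L_0. -/

import Mathlib

open scoped TensorProduct

/-- A field extension `E/K` is regular iff `E/K` is separable and `K` is algebraically
closed in `E`; equivalently (and this is the formulation used here), `E` is linearly
disjoint from an algebraic closure of `K`, i.e. `E ⊗[K] K̄` is an integral domain. -/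
def IsRegularExtension (K E : Type) [Field K] [Field E] [Algebra K E] : Prop :=
  IsDomain (E ⊗[K] (AlgebraicClosure K))

lemma aux_domain (L σ M : Type) [Field L] [Field M] [Algebra L M] :
    IsDomain (FractionRing (MvPolynomial σ L) ⊗[L] M) := by
  let A := MvPolynomial σ L
  let f : (A ⊗[L] M) →ₐ[L] (FractionRing A ⊗[L] M) :=
    Algebra.TensorProduct.map (IsScalarTower.toAlgHom L A (FractionRing A)) (AlgHom.id L M)
  let : Algebra (A ⊗[L] M) (FractionRing A ⊗[L] M) := f.toRingHom.toAlgebra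
  have hf : ∀ z, algebraMap (A ⊗[L] M) (FractionRing A ⊗[L] M) z = f z := fun _ => rfl
  have : IsScalarTower A (A ⊗[L] M) (FractionRing A ⊗[L] M) :=
    IsScalarTower.of_algebraMap_eq (R := A) (S := A ⊗[L] M) (A := FractionRing A ⊗[L] M) (by
      intro a
      rw [hf]
      change _ = f (a ⊗ₜ 1)
      simp [Algebra.TensorProduct.algebraMap_apply, f])
  have hloc := IsLocalization.tensorProduct_tensorProduct L M (nonZeroDivisors A) (FractionRing A)
    (by
      apply RingHom.ext
      intro a
      rw [RingHom.comp_apply, hf]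
      simp [f])
  let e : (A ⊗[L] M) ≃ₐ[L] MvPolynomial σ M :=
    (Algebra.TensorProduct.comm L A M).trans
      ((MvPolynomial.algebraTensorAlgEquiv (σ := σ) L M).restrictScalars L)
  have : IsDomain (A ⊗[L] M) := e.toMulEquiv.isDomain _
  refine IsLocalization.isDomain_of_le_nonZeroDivisors (R := A ⊗[L] M) _
    (M := Algebra.algebraMapSubmonoid (A ⊗[L] M) (nonZeroDivisors A)) ?_
  rintro _ ⟨a, ha, rfl⟩
  apply mem_nonZeroDivisors_of_ne_zero
  have hinj : Function.Injective (algebraMap A (A ⊗[L] M)) := 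
    Algebra.TensorProduct.includeLeft_injective (S := A) (algebraMap L M).injective
  exact fun h => nonZeroDivisors.ne_zero ha (hinj (h.trans (map_zero _).symm))

section
variable {K L : Type} [Field K] [Field L] [Algebra K L] [FiniteDimensional K L] [IsGalois K L]

/-- dual family for the trace form, in terms of Galois conjugates -/
lemma aux_dual {ι : Type} [Fintype ι] [DecidableEq ι] (a : Module.Basis ι K L) :
    ∃ d : ι → L, ∀ i j, ∑ σ : L ≃ₐ[K] L, σ (a i) * σ (d j) = if i = j then 1 else 0 := by
  refine ⟨(Algebra.traceForm K L).dualBasis (traceForm_nondegenerate K L) a, fun i j => ?_⟩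
  have := (Algebra.traceForm K L).apply_dualBasis_right (traceForm_nondegenerate K L)
    (Algebra.traceForm_isSymm K) a i j
  rw [Algebra.traceForm_apply] at this
  have h2 := congrArg (algebraMap K L) this
  rw [trace_eq_sum_automorphisms] at h2
  simp only [map_mul] at h2
  rw [h2]
  split_ifs <;> simp

lemma aux_dual' {ι : Type} [Fintype ι] [DecidableEq ι] (a : Module.Basis ι K L) (d : ι → L)
    (h : ∀ i j, ∑ σ : L ≃ₐ[K] L, σ (a i) * σ (d j) = if i = j then 1 else 0)
    [DecidableEq (L ≃ₐ[K] L)] (σ τ : L ≃ₐ[K] L) :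
    ∑ i, σ (d i) * τ (a i) = if σ = τ then 1 else 0 := by
  let A : Matrix ι (L ≃ₐ[K] L) L := Matrix.of fun i σ => σ (a i)
  let D : Matrix (L ≃ₐ[K] L) ι L := Matrix.of fun σ i => σ (d i)
  have h1 : A * D = 1 := by
    ext i j
    simp [A, D, Matrix.mul_apply, h, Matrix.one_apply]
  have h2 : D * A = 1 := by
    rw [Matrix.mul_eq_one_comm_of_card_eq] at h1
    · exact h1
    · rw [← Nat.card_eq_fintype_card (α := L ≃ₐ[K] L), IsGalois.card_aut_eq_finrank, Module.finrank_eq_card_basis a]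
  have := congrFun (congrFun h2 σ) τ
  simpa [A, D, Matrix.mul_apply, Matrix.one_apply] using this

end

section FG
variable {K E F : Type} [Field K] [Field E] [Field F] [Algebra K E] [Algebra E F] [Algebra K F]
  [IsScalarTower K E F]

lemma aux_fg [FiniteDimensional E F] (S : Finset F)
    (hS : IntermediateField.adjoin K (S : Set F) = ⊤) :
    ∃ s : Finset E, IntermediateField.adjoin K (s : Set E) = ⊤ := by
  classical
  let C : Finset E := S.biUnion fun s => (minpoly E s).coeffs
  let E' := IntermediateField.adjoin K (C : Set E)
  have hint : ∀ s ∈ S, IsIntegral E' s := by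
    intro s hs
    have hl : minpoly E s ∈ Polynomial.lifts (algebraMap E' E) := by
      rw [Polynomial.lifts_iff_coeff_lifts]
      intro n
      by_cases h0 : (minpoly E s).coeff n = 0
      · exact ⟨0, by simp [h0]⟩
      · refine ⟨⟨(minpoly E s).coeff n, IntermediateField.subset_adjoin K _ ?_⟩, rfl⟩
        simp only [C, Finset.coe_biUnion, Set.mem_iUnion]
        exact ⟨s, hs, Polynomial.coeff_mem_coeffs h0⟩
    obtain ⟨q, hq, -, hqm⟩ := Polynomial.lifts_and_degree_eq_and_monic hl
      (minpoly.monic (Algebra.IsIntegral.isIntegral s))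
    refine ⟨q, hqm, ?_⟩
    have := minpoly.aeval E s
    rw [← hq, Polynomial.aeval_map_algebraMap] at this
    exact this
  have hfin : FiniteDimensional E' (IntermediateField.adjoin E' (S : Set F)) :=
    IntermediateField.finiteDimensional_adjoin hint
  have htop : IntermediateField.adjoin E' (S : Set F) = ⊤ := by
    rw [eq_top_iff]
    intro x _
    have hx : x ∈ IntermediateField.adjoin K (S : Set F) := by rw [hS]; trivial
    have : IntermediateField.adjoin K (S : Set F) ≤
      (IntermediateField.adjoin E' (S : Set F)).restrictScalars K :=
      IntermediateField.adjoin_le_iff.2 (IntermediateField.subset_adjoin E' _)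
    exact this hx
  rw [htop] at hfin
  have hfin2 : FiniteDimensional E' F :=
    LinearEquiv.finiteDimensional (IntermediateField.topEquiv (F := E') (E := F)).toLinearEquiv
  have hfin3 : FiniteDimensional E' E := FiniteDimensional.left E' E F
  obtain ⟨T, hT⟩ := IntermediateField.fg_of_noetherian (⊤ : IntermediateField E' E)
  refine ⟨C ∪ T, ?_⟩
  rw [Finset.coe_union, ← IntermediateField.adjoin_adjoin_left, hT]
  rfl
end FG

section
variable {K L E F : Type} [Field K] [Field L] [Field E] [Field F] [Algebra K L] [Algebra K E]
  [Algebra K F] [Algebra E F] [Algebra L F] [IsScalarTower K L F] [IsScalarTower K E F]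
  [FiniteDimensional K L] [IsGalois K L]

lemma aux_inj (hg : ∀ σ : L ≃ₐ[K] L, ∃ g : F →+* F,
      (∀ l, g (algebraMap L F l) = algebraMap L F (σ l)) ∧
      ∀ e, g (algebraMap E F e) = algebraMap E F e) :
    Function.Injective (Algebra.TensorProduct.lift (Algebra.ofId L F)
      (IsScalarTower.toAlgHom K E F) (fun _ _ => Commute.all _ _)) := by
  classical
  rw [injective_iff_map_eq_zero]
  intro z hz
  let a := Module.finBasis K L
  obtain ⟨d, hd⟩ := aux_dual a
  obtain ⟨c, rfl⟩ := TensorProduct.eq_repr_basis_left a z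
  have hz' : ∑ i, algebraMap L F (a i) * algebraMap E F (c i) = 0 := by
    rw [← hz, Finsupp.sum_fintype _ _ (by simp), map_sum]
    refine Finset.sum_congr rfl fun i _ => ?_
    rw [Algebra.TensorProduct.lift_tmul]
    rfl
  have h1 : ∀ σ : L ≃ₐ[K] L, ∑ i, algebraMap L F (σ (a i)) * algebraMap E F (c i) = 0 := by
    intro σ
    obtain ⟨g, hgl, hge⟩ := hg σ
    have := congrArg g hz'
    simpa [map_sum, hgl, hge] using this
  have h2 : ∀ j, c j = 0 := by
    intro j
    have h3 : ∑ σ : L ≃ₐ[K] L, algebraMap L F (σ (d j)) *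
        ∑ i, algebraMap L F (σ (a i)) * algebraMap E F (c i) = 0 := by
      simp [h1]
    simp_rw [Finset.mul_sum] at h3
    rw [Finset.sum_comm] at h3
    have h4 : ∀ i, ∑ σ : L ≃ₐ[K] L, algebraMap L F (σ (d j)) *
        (algebraMap L F (σ (a i)) * algebraMap E F (c i)) =
        (if i = j then 1 else 0) * algebraMap E F (c i) := by
      intro i
      have := congrArg (algebraMap L F) (hd i j)
      rw [map_sum] at this
      rw [show (if i = j then (1 : F) else 0) = algebraMap L F (if i = j then 1 else 0) by
        split_ifs <;> simp, ← this, Finset.sum_mul]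
      refine Finset.sum_congr rfl fun σ _ => ?_
      rw [map_mul]; ring
    simp_rw [h4] at h3
    simpa using h3
  have : c = 0 := Finsupp.ext h2
  simp [this]

lemma aux_regular (hg : ∀ σ : L ≃ₐ[K] L, ∃ g : F →+* F,
      (∀ l, g (algebraMap L F l) = algebraMap L F (σ l)) ∧
      ∀ e, g (algebraMap E F e) = algebraMap E F e)
    (M : Type) [Field M] [Algebra K M] [Algebra L M] [IsScalarTower K L M]
    (hM : IsDomain (F ⊗[L] M)) : IsDomain (E ⊗[K] M) := by
  let f : L ⊗[K] E →ₐ[L] F := Algebra.TensorProduct.lift (Algebra.ofId L F)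
      (IsScalarTower.toAlgHom K E F) (fun _ _ => Commute.all _ _)
  have hf : Function.Injective f := aux_inj hg
  have h1 : Function.Injective (LinearMap.lTensor M f.toLinearMap) :=
    Module.Flat.lTensor_preserves_injective_linearMap _ hf
  have : IsDomain (M ⊗[L] F) := (Algebra.TensorProduct.comm L M F).toMulEquiv.isDomain _
  have h2 : IsDomain (M ⊗[L] (L ⊗[K] E)) :=
    Function.Injective.isDomain (Algebra.TensorProduct.map (AlgHom.id L M) f).toRingHom h1
  have h3 : IsDomain (M ⊗[K] E) :=
    (Algebra.TensorProduct.cancelBaseChange K L L M E).symm.toMulEquiv.isDomain _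
  exact (Algebra.TensorProduct.comm K E M).toMulEquiv.isDomain _
end

section
variable {K L F : Type} [Field K] [Field L] [Field F] [Algebra K L]
  [Algebra K F] [Algebra L F] [IsScalarTower K L F]
  [FiniteDimensional K L] [IsGalois K L]

lemma aux_pt (φ : (L ≃ₐ[K] L) → F →+* F)
    (hφ : ∀ σ l, φ σ (algebraMap L F l) = algebraMap L F (σ l))
    {Q : Type} (y : Q × (L ≃ₐ[K] L) → F) (hφy : ∀ τ q σ, φ τ (y (q, σ)) = y (q, τ * σ))
    (hy : AlgebraicIndependent L y)
    (hgen : IntermediateField.adjoin L (Set.range y) = ⊤) :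
    ∃ t : Set F, AlgebraicIndependent L ((↑) : t → F) ∧
      ∀ z, z ∈ IntermediateField.adjoin K t ↔ ∀ σ, φ σ z = z := by
  classical
  let a := Module.finBasis K L
  obtain ⟨d, hd⟩ := aux_dual a
  have hd' := aux_dual' a d hd
  let t : Q × Fin (Module.finrank K L) → F :=
    fun p => ∑ σ : L ≃ₐ[K] L, algebraMap L F (σ (a p.2)) * y (p.1, σ)
  have ht : AlgebraicIndependent L t := by
    let P : Q × Fin (Module.finrank K L) → MvPolynomial (Q × (L ≃ₐ[K] L)) L :=
      fun p => ∑ σ : L ≃ₐ[K] L, MvPolynomial.C (σ (a p.2)) * MvPolynomial.X (p.1, σ)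
    let P' : Q × (L ≃ₐ[K] L) → MvPolynomial (Q × Fin (Module.finrank K L)) L :=
      fun p => ∑ i, MvPolynomial.C (p.2 (d i)) * MvPolynomial.X (p.1, i)
    have h1 : (MvPolynomial.aeval P').comp (MvPolynomial.aeval P) = AlgHom.id L _ := by
      apply MvPolynomial.algHom_ext
      rintro ⟨q, i⟩
      simp only [AlgHom.comp_apply, MvPolynomial.aeval_X, P, map_sum, map_mul,
        MvPolynomial.aeval_C, MvPolynomial.algebraMap_eq, AlgHom.id_apply, P', Finset.mul_sum]
      rw [Finset.sum_comm]
      have hd2 : ∀ j, ∑ σ : L ≃ₐ[K] L, σ (a i * d j) = if i = j then 1 else 0 := by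
        intro j
        rw [← hd i j]
        simp
      simp_rw [← mul_assoc, ← map_mul, ← Finset.sum_mul, ← map_sum, hd2]
      rw [Finset.sum_eq_single i]
      · simp
      · intro j _ hj
        rw [if_neg (Ne.symm hj)]; simp
      · simp
    have h2 : (MvPolynomial.aeval y).comp (MvPolynomial.aeval P) =
        (MvPolynomial.aeval t : _ →ₐ[L] F) := by
      apply MvPolynomial.algHom_ext
      rintro ⟨q, i⟩
      simp [P, t]
    have h3 : Function.Injective (MvPolynomial.aeval P : _ →ₐ[L] _) := by
      apply Function.LeftInverse.injective (g := (MvPolynomial.aeval P' : _ →ₐ[L] _))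
      intro z
      exact congrArg (fun f => f z) h1
    change Function.Injective (MvPolynomial.aeval t)
    rw [← h2, AlgHom.coe_comp]
    exact Function.Injective.comp hy h3
  have hyt : ∀ q τ, y (q, τ) = ∑ i, algebraMap L F (τ (d i)) * t (q, i) := by
    intro q τ
    simp only [t, Finset.mul_sum]
    rw [Finset.sum_comm]
    simp_rw [← mul_assoc, ← map_mul, ← Finset.sum_mul, ← map_sum, hd']
    rw [Finset.sum_eq_single τ]
    · simp
    · intro j _ hj
      rw [if_neg (Ne.symm hj)]; simp
    · simp
  have hφt : ∀ τ p, φ τ (t p) = t p := by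
    intro τ p
    simp only [t, map_sum, map_mul, hφ, hφy]
    exact Fintype.sum_equiv (Equiv.mulLeft τ) _ _ (fun σ => by simp)
  refine ⟨Set.range t, AlgebraicIndependent.coe_range ht, fun z => ?_⟩
  let F0 := IntermediateField.adjoin K (Set.range t)
  have hF0 : ∀ z ∈ F0, ∀ σ, φ σ z = z := by
    intro z hz σ
    have hle : F0.toSubfield ≤ RingHom.eqLocusField (φ σ) (RingHom.id F) := by
      change Subfield.closure _ ≤ _
      rw [Subfield.closure_le]
      rintro _ (⟨k, rfl⟩ | ⟨p, rfl⟩)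
      · change φ σ _ = _
        rw [IsScalarTower.algebraMap_apply K L F, hφ, AlgEquiv.commutes]; rfl
      · exact hφt σ p
    exact hle hz
  refine ⟨hF0 z, fun hz => ?_⟩
  -- `F` is spanned by `L` over `F0`
  have hint : ∀ x ∈ Set.range (algebraMap L F), IsAlgebraic F0 x := by
    rintro _ ⟨l, rfl⟩
    have h1 : IsIntegral K (algebraMap L F l) :=
      (Algebra.IsIntegral.isIntegral (R := K) l).algebraMap
    exact (h1.tower_top).isAlgebraic
  have htop : IntermediateField.adjoin F0 (Set.range (algebraMap L F)) = ⊤ := by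
    rw [eq_top_iff]
    intro x _
    have hx : x ∈ IntermediateField.adjoin L (Set.range y) := by rw [hgen]; trivial
    have hle : (IntermediateField.adjoin L (Set.range y)).toSubfield ≤
        (IntermediateField.adjoin F0 (Set.range (algebraMap L F))).toSubfield := by
      change Subfield.closure _ ≤ _
      rw [Subfield.closure_le]
      have hL : ∀ l, algebraMap L F l ∈
          (IntermediateField.adjoin F0 (Set.range (algebraMap L F))) :=
        fun l => IntermediateField.subset_adjoin _ _ ⟨l, rfl⟩
      rintro _ (⟨k, rfl⟩ | ⟨⟨q, τ⟩, rfl⟩)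
      · exact hL k
      · change _ ∈ (IntermediateField.adjoin F0 (Set.range (algebraMap L F)))
        rw [hyt]
        refine sum_mem fun i _ => mul_mem (hL _) ?_
        exact IntermediateField.algebraMap_mem _
          (⟨t (q, i), IntermediateField.subset_adjoin _ _ ⟨_, rfl⟩⟩ : F0)
    exact hle hx
  have hspan : ∀ w : F, w ∈ Submodule.span F0 (Set.range (algebraMap L F)) := by
    intro w
    have hw : w ∈ (IntermediateField.adjoin F0 (Set.range (algebraMap L F))).toSubalgebra := by
      rw [htop]; trivial
    rw [IntermediateField.adjoin_toSubalgebra_of_isAlgebraic hint] at hw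
    have hw2 : w ∈ Subalgebra.toSubmodule (Algebra.adjoin F0 (Set.range (algebraMap L F))) := hw
    rw [Algebra.adjoin_eq_span] at hw2
    have : (Submonoid.closure (Set.range (algebraMap L F)) : Set F) =
        Set.range (algebraMap L F) := by
      have := Submonoid.closure_eq (MonoidHom.mrange (algebraMap L F : L →* F))
      exact congrArg (fun s : Submonoid F => (s : Set F)) this
    rwa [this] at hw2
  have htr : ∀ l : L, ∑ σ : L ≃ₐ[K] L, algebraMap L F (σ l) ∈ F0 := by
    intro l
    rw [← map_sum, ← trace_eq_sum_automorphisms, ← IsScalarTower.algebraMap_apply K L F]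
    exact F0.algebraMap_mem _
  have hsum : ∀ w : F, ∑ σ : L ≃ₐ[K] L, φ σ w ∈ F0 := by
    intro w
    refine Submodule.span_induction (p := fun w _ => ∑ σ : L ≃ₐ[K] L, φ σ w ∈ F0)
      ?_ ?_ ?_ ?_ (hspan w)
    · rintro _ ⟨l, rfl⟩
      simp_rw [hφ]
      exact htr l
    · simp
    · intro u v _ _ hu hv
      simp_rw [map_add, Finset.sum_add_distrib]
      exact add_mem hu hv
    · intro c u _ hu
      have : ∀ σ, φ σ (c • u) = (c : F) * φ σ u := by
        intro σ
        rw [Algebra.smul_def, map_mul]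
        congr 1
        exact hF0 c c.2 σ
      simp_rw [this, ← Finset.mul_sum]
      exact mul_mem c.2 hu
  obtain ⟨c, hc⟩ := Algebra.trace_surjective K L 1
  have hc' := congrArg (algebraMap K L) hc
  rw [trace_eq_sum_automorphisms, map_one] at hc'
  have h5 := hsum (algebraMap L F c * z)
  simp_rw [map_mul, hφ, hz, ← Finset.sum_mul, ← map_sum] at h5
  rw [hc', map_one, one_mul] at h5
  exact h5
end

section
variable {K L : Type} [Field K] [Field L] [Algebra K L] {B : Type} [Group B]

/-- The semilinear action on polynomials. -/
noncomputable def auxRho (ψ : B →* (L ≃ₐ[K] L)) :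
    B →* (MvPolynomial B L →+* MvPolynomial B L) where
  toFun b := MvPolynomial.eval₂Hom (MvPolynomial.C.comp ((ψ b : L ≃+* L) : L →+* L))
    (fun c => MvPolynomial.X (c * b⁻¹))
  map_one' := by
    apply MvPolynomial.ringHom_ext <;> intros <;> simp
  map_mul' b b' := by
    apply MvPolynomial.ringHom_ext <;> intros <;> simp [mul_assoc]

lemma auxRho_C (ψ : B →* (L ≃ₐ[K] L)) (b : B) (l : L) :
    auxRho ψ b (MvPolynomial.C l) = MvPolynomial.C (ψ b l) := by
  simp [auxRho]

lemma auxRho_X (ψ : B →* (L ≃ₐ[K] L)) (b c : B) :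
    auxRho ψ b (MvPolynomial.X c) = MvPolynomial.X (c * b⁻¹) := by
  simp [auxRho]

lemma aux_exists (ψ : B →* (L ≃ₐ[K] L)) :
    ∃ (F : Type) (_ : Field F) (_ : Algebra K F) (_ : Algebra L F) (_ : IsScalarTower K L F)
      (_ : MulSemiringAction B F) (x : B → F),
      AlgebraicIndependent L x ∧ IntermediateField.adjoin L (Set.range x) = ⊤ ∧
      (∀ (b : B) (l : L), b • algebraMap L F l = algebraMap L F (ψ b l)) ∧
      (∀ b c : B, b • x c = x (c * b⁻¹)) ∧
      ∀ (M : Type) [Field M] [Algebra L M], IsDomain (F ⊗[L] M) := by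
  let R := MvPolynomial B L
  let act : MulSemiringAction B R := MulSemiringAction.compHom R (auxRho ψ)
  have hact : ∀ (b : B) (p : R), b • p = auxRho ψ b p := fun _ _ => rfl
  let actF := IsFractionRing.mulSemiringAction B R (FractionRing R)
  have hd : SMulDistribClass B R (FractionRing R) := IsFractionRing.smulDistribClass B R _
  have hF : ∀ (b : B) (p : R), b • algebraMap R (FractionRing R) p =
      algebraMap R (FractionRing R) (b • p) := fun b p => (algebraMap.coe_smul' b p _).symm
  refine ⟨FractionRing R, inferInstance, inferInstance, inferInstance, inferInstance, actF,
    fun c => algebraMap R _ (MvPolynomial.X c), ?_, ?_, ?_, ?_, fun M _ _ => aux_domain L B M⟩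
  · have := (MvPolynomial.algebraicIndependent_X B L).map' 
      (f := IsScalarTower.toAlgHom L R (FractionRing R)) (IsFractionRing.injective R _)
    exact this
  · rw [eq_top_iff]
    intro z _
    have key : ∀ p : R, algebraMap R (FractionRing R) p ∈ IntermediateField.adjoin L
        (Set.range fun c : B => algebraMap R (FractionRing R) (MvPolynomial.X c)) := by
      intro p
      induction p using MvPolynomial.induction_on with
      | C l => 
        have := IntermediateField.algebraMap_mem (IntermediateField.adjoin L
          (Set.range fun c : B => algebraMap R (FractionRing R) (MvPolynomial.X c))) l
        rwa [IsScalarTower.algebraMap_apply L R (FractionRing R)] at this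
      | add p q hp hq => rw [map_add]; exact add_mem hp hq
      | mul_X p c hp => 
        rw [map_mul]
        exact mul_mem hp (IntermediateField.subset_adjoin _ _ ⟨c, rfl⟩)
    obtain ⟨p, q, -, rfl⟩ := IsFractionRing.div_surjective R z
    exact div_mem (key p) (key q)
  · intro b l
    rw [IsScalarTower.algebraMap_apply L R (FractionRing R), hF, hact,
      IsScalarTower.algebraMap_apply L R (FractionRing R)]
    exact congrArg _ (auxRho_C ψ b l)
  · intro b c
    change b • algebraMap R _ _ = _
    rw [hF, hact, auxRho_X]
end


theorem stmt16 (K L : Type) [Field K] [Field L] [Algebra K L]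
    [FiniteDimensional K L] [IsGalois K L]
    (B : Type) [Group B] [Finite B] (ψ : B →* (L ≃ₐ[K] L)) (hψ : Function.Surjective ψ)
    (L0 : IntermediateField K L) (B0 : Subgroup B)
    -- `ψ` maps `B0` isomorphically onto `Gal(L/L0)`
    (hB0 : Set.BijOn ψ (B0 : Set B) (L0.fixingSubgroup : Set (L ≃ₐ[K] L))) :
    ∃ (E : Type) (_ : Field E) (_ : Algebra K E)
      (F : Type) (_ : Field F) (_ : Algebra K F) (_ : Algebra E F) (_ : Algebra L F)
      (_ : IsScalarTower K E F) (_ : IsScalarTower K L F),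
      -- `E/K` is a finitely generated field extension
      (∃ s : Finset E, IntermediateField.adjoin K (s : Set E) = ⊤) ∧
      -- `E/K` is regular
      IsRegularExtension K E ∧
      -- `F/E` is a finite Galois extension
      FiniteDimensional E F ∧ IsGalois E F ∧
      -- `Gal(F/E) = B`, `ψ` coincides with the restriction map `Gal(F/E) → Gal(L/K)`,
      ∃ e : B ≃* (F ≃ₐ[E] F),
        (∀ (b : B) (x : L), (e b) (algebraMap L F x) = algebraMap L F (ψ b x)) ∧
        -- and the fixed field `F0` of `B0` in `F` is purely transcendental over `L0`
        ∃ t : Set F,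
          AlgebraicIndependent ↥(L0.map (IsScalarTower.toAlgHom K L F)) ((↑) : t → F) ∧
          ((IntermediateField.adjoin ↥(L0.map (IsScalarTower.toAlgHom K L F)) t :
              IntermediateField ↥(L0.map (IsScalarTower.toAlgHom K L F)) F) : Set F) =
            ((IntermediateField.fixedField (B0.map e.toMonoidHom) :
              IntermediateField E F) : Set F) := by
  classical
  obtain ⟨F, _, _, _, _, _, x, hx, hgen, hL, hX, hdom⟩ := aux_exists ψ
  have hcomm : SMulCommClass B K F := ⟨fun b k z => by
    rw [Algebra.smul_def, Algebra.smul_def, smul_mul', IsScalarTower.algebraMap_apply K L F, hL,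
      AlgEquiv.commutes]⟩
  have hfaith : FaithfulSMul B F := ⟨fun {b b'} h => by
    have := h (x 1)
    rw [hX, hX] at this
    simpa using hx.injective this⟩
  let E : IntermediateField K F := FixedPoints.intermediateField B
  have hEmem : ∀ z : F, z ∈ E ↔ ∀ b : B, b • z = z := fun z => Iff.rfl
  have hgal : IsGaloisGroup B E F :=
    { faithful := hfaith
      commutes := ⟨fun b e z => by
        rw [Algebra.smul_def, Algebra.smul_def, smul_mul']
        congr 1
        exact (hEmem _).1 e.2 b⟩
      isInvariant := ⟨fun z hz => ⟨⟨z, hz⟩, rfl⟩⟩ }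
  have hfd : FiniteDimensional E F := IsGaloisGroup.finiteDimensional B E F
  have hig : IsGalois E F := IsGaloisGroup.isGalois B E F
  refine ⟨E, inferInstance, inferInstance, F, inferInstance, inferInstance, inferInstance,
    inferInstance, inferInstance, inferInstance, ?_, ?_, hfd, hig,
    IsGaloisGroup.mulEquivAlgEquiv B E F, ?_, ?_⟩
  · -- finite generation
    let S : Finset F := (Set.finite_range x).toFinset ∪
      Finset.univ.image (fun i => algebraMap L F (Module.finBasis K L i))
    apply aux_fg S
    rw [eq_top_iff]
    intro z _
    have hz : z ∈ IntermediateField.adjoin L (Set.range x) := by rw [hgen]; trivial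
    have hle : (IntermediateField.adjoin L (Set.range x)).toSubfield ≤
        (IntermediateField.adjoin K (S : Set F)).toSubfield := by
      change Subfield.closure _ ≤ _
      rw [Subfield.closure_le]
      rintro _ (⟨l, rfl⟩ | ⟨c, rfl⟩)
      · change _ ∈ IntermediateField.adjoin K (S : Set F)
        rw [← (Module.finBasis K L).sum_repr l, map_sum]
        refine sum_mem fun i _ => ?_
        rw [Algebra.smul_def, map_mul, ← IsScalarTower.algebraMap_apply K L F]
        refine mul_mem (IntermediateField.algebraMap_mem _ _)
          (IntermediateField.subset_adjoin _ _ ?_)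
        simp [S]
      · refine IntermediateField.subset_adjoin _ _ ?_
        simp [S]
    exact hle hz
  · -- regularity
    let j : L →ₐ[K] AlgebraicClosure K := IsAlgClosed.lift
    let _ : Algebra L (AlgebraicClosure K) := j.toRingHom.toAlgebra
    have : IsScalarTower K L (AlgebraicClosure K) :=
      IsScalarTower.of_algebraMap_eq fun k => (j.commutes k).symm
    refine aux_regular (L := L) (F := F) (fun σ => ?_) _ (hdom _)
    obtain ⟨b, rfl⟩ := hψ σ
    exact ⟨MulSemiringAction.toRingHom B F b, hL b, fun e => (hEmem _).1 e.2 b⟩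
  · intro b l
    rw [← hL]
    rfl
  · -- the fixed field of `B0`
    have hs : ∀ h : L ≃ₐ[L0] L, ∃ b ∈ B0, ψ b = h.restrictScalars K := by
      intro h
      have hm : h.restrictScalars K ∈ (L0.fixingSubgroup : Set (L ≃ₐ[K] L)) := by
        rw [SetLike.mem_coe, IntermediateField.mem_fixingSubgroup_iff]
        intro l hl
        exact h.commutes ⟨l, hl⟩
      obtain ⟨b, hb, hb'⟩ := hB0.surjOn hm
      exact ⟨b, hb, hb'⟩
    choose s hsB hsψ using hs
    have hsurj : ∀ b ∈ B0, ∃ h, s h = b := by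
      intro b hb
      have hm := hB0.mapsTo hb
      refine ⟨L0.fixingSubgroupEquiv ⟨ψ b, hm⟩, hB0.injOn (hsB _) hb ?_⟩
      rw [hsψ]
      rfl
    have hsmul : ∀ h g, s (h * g) = s h * s g := by
      intro h g
      apply hB0.injOn (hsB _) (mul_mem (hsB _) (hsB _))
      rw [map_mul, hsψ, hsψ, hsψ]
      rfl
    have hsinj : Function.Injective s := by
      intro h g hhg
      have := congrArg ψ hhg
      rw [hsψ, hsψ] at this
      exact AlgEquiv.restrictScalars_injective K this
    let m : (B ⧸ B0) × (L ≃ₐ[L0] L) → B := fun p => p.1.out * (s p.2)⁻¹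
    have hm1 : ∀ p, (QuotientGroup.mk (m p) : B ⧸ B0) = p.1 := by
      intro p
      rw [QuotientGroup.mk_mul_of_mem _ (inv_mem (hsB _))]
      exact QuotientGroup.out_eq' _
    have hminj : Function.Injective m := by
      rintro ⟨q, h⟩ ⟨q', h'⟩ hh
      have h1 : q = q' := (hm1 (q, h)).symm.trans ((congrArg _ hh).trans (hm1 (q', h')))
      subst h1
      simp only [m, mul_right_inj, inv_inj] at hh
      rw [hsinj hh]
    have hmsurj : Function.Surjective m := by
      intro c
      have : ((QuotientGroup.mk c : B ⧸ B0).out⁻¹ * c)⁻¹ ∈ B0 :=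
        inv_mem (QuotientGroup.eq.1 (QuotientGroup.out_eq' _))
      obtain ⟨h, hh⟩ := hsurj _ this
      exact ⟨(QuotientGroup.mk c, h), by simp [m, hh]⟩
    obtain ⟨t, ht, hfix⟩ := aux_pt (K := L0) (L := L) (F := F)
      (fun h => MulSemiringAction.toRingHom B F (s h))
      (fun h l => by
        change s h • algebraMap L F l = _
        rw [hL, hsψ]; rfl)
      (x ∘ m)
      (fun τ q σ => by
        change s τ • x _ = x _
        rw [hX]
        simp [m, mul_assoc, hsmul])
      (hx.comp _ hminj)
      (by rw [hmsurj.range_comp, hgen])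
    refine ⟨t, ?_, ?_⟩
    · let f := (L0.equivMap (IsScalarTower.toAlgHom K L F)).symm
      refine AlgebraicIndependent.of_ringHom_of_comp_eq
        ((algebraMap L0 L).comp f.toRingEquiv.toRingHom) (RingHom.id F) ht
        (RingHom.injective _) ?_
      apply RingHom.ext
      intro z
      obtain ⟨w, rfl⟩ := (L0.equivMap (IsScalarTower.toAlgHom K L F)).surjective z
      simp [f]
    · ext z
      have h1 : z ∈ (IntermediateField.adjoin ↥(L0.map (IsScalarTower.toAlgHom K L F)) t) ↔
          z ∈ IntermediateField.adjoin L0 t := by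
        change z ∈ Subfield.closure _ ↔ z ∈ Subfield.closure _
        have : Set.range (algebraMap ↥(L0.map (IsScalarTower.toAlgHom K L F)) F) =
            Set.range (algebraMap L0 F) := by
          ext w
          constructor
          · rintro ⟨⟨_, l, hl, rfl⟩, rfl⟩
            exact ⟨⟨l, hl⟩, rfl⟩
          · rintro ⟨l, rfl⟩
            exact ⟨⟨_, l, l.2, rfl⟩, rfl⟩
        rw [this]
      rw [SetLike.mem_coe, h1, hfix, SetLike.mem_coe, IntermediateField.mem_fixedField_iff]
      constructor
      · rintro h _ ⟨b, hb, rfl⟩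
        obtain ⟨g, rfl⟩ := hsurj b hb
        exact h g
      · intro h g
        exact h _ ⟨s g, hsB g, rfl⟩
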